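/- arXiv:1208.2561 — 4 statements merged into one kernel-verified Lean document; each statement's English description precedes it below -/
import Mathlib

section
/- Let n, m ≥ 1, 0 < ε < 1, 0 < p ≤ 1/2, and let 0 < t̃_0 ≤ 1. Define P := (m/ε) · 2^{−p·n·t̃_0 / (2·log₂(512/t̃_0))}. If P < 1 and t̃_0·n + m + 1 ≤ n, then the random hash function ĥ is a (t̃_0·n + m + 1, ε)-hash function for flat distributions with probability at least (1−P)^m, and (1−P)^m > 0. -/
open Finset

theorem ite_one_zero_mono {a b : Prop} [Decidable a] [Decidable b] (h : a → b) :
    (if a then (1 : ℝ) else 0) ≤ if b then 1 else 0 := by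
  by_cases ha : a
  · simp [ha, h ha]
  · rw [if_neg ha]; split_ifs <;> norm_num

/-- If a random function `h S` splits every set of size at least `B` in proportions
between `a` and `b` with probability at least `c`, then `k` independent copies split every
sufficiently large set in proportions between `a ^ k` and `b ^ k` with probability at least
`c ^ k`. -/
theorem pow_le_sum_prod_of_splits {α X Y : Type*} [Fintype α] [DecidableEq Y]
    (μ : α → ℝ) (hμ : ∀ S, 0 ≤ μ S) (h : α → X → Y) {a b c B : ℝ}
    (ha : 0 ≤ a) (hb : 0 ≤ b) (hc : 0 ≤ c)
    (H : ∀ (A : Finset X) (y : Y), B ≤ #A →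
      c ≤ ∑ S, μ S * (if a * #A ≤ #(A.filter (fun x => h S x = y)) ∧
        (#(A.filter (fun x => h S x = y)) : ℝ) ≤ b * #A then 1 else 0))
    (k : ℕ) (A : Finset X) (y : Fin k → Y) (hA : ∀ j < k, B ≤ a ^ j * #A) :
    c ^ k ≤ ∑ Sv : Fin k → α, (∏ i, μ (Sv i)) *
      (if a ^ k * #A ≤ #(A.filter (fun x => ∀ i, h (Sv i) x = y i)) ∧
        (#(A.filter (fun x => ∀ i, h (Sv i) x = y i)) : ℝ) ≤ b ^ k * #A then 1 else 0) := by
  induction k generalizing A with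
  | zero => simp
  | succ k ih =>
    rw [← (Fin.consEquiv (fun _ => α)).sum_comp, Fintype.sum_prod_type]
    have h0 : B ≤ #A := by simpa using hA 0 (Nat.succ_pos k)
    calc c ^ (k + 1) = c * c ^ k := pow_succ' c k
      _ ≤ (∑ S, μ S * (if a * #A ≤ #(A.filter (fun x => h S x = y 0)) ∧
        (#(A.filter (fun x => h S x = y 0)) : ℝ) ≤ b * #A then 1 else 0)) * c ^ k := by
          gcongr
          exact H A (y 0) h0
      _ ≤ _ := by
          rw [Finset.sum_mul]
          refine Finset.sum_le_sum fun S _ => ?_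
          have hfilter : ∀ Sv : Fin k → α,
              A.filter (fun x => ∀ i, h (Fin.consEquiv (fun _ => α) (S, Sv) i) x = y i) =
              (A.filter (fun x => h S x = y 0)).filter
                (fun x => ∀ i, h (Sv i) x = y i.succ) := by
            intro Sv
            ext x
            simp [Fin.forall_fin_succ, Fin.consEquiv, and_assoc]
          simp only [hfilter, Fin.prod_univ_succ]
          simp only [Fin.consEquiv, Equiv.coe_fn_mk, Fin.cons_zero, Fin.cons_succ, mul_assoc]
          rw [← Finset.mul_sum]
          refine mul_le_mul_of_nonneg_left ?_ (hμ S)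
          split_ifs with hS
          · rw [one_mul]
            refine (ih (A.filter (fun x => h S x = y 0)) (fun i => y i.succ) ?_).trans ?_
            · intro j hj
              calc B ≤ a ^ (j + 1) * #A := hA (j + 1) (by omega)
                _ = a ^ j * (a * #A) := by ring
                _ ≤ _ := by gcongr; exact hS.1
            · refine Finset.sum_le_sum fun Sv _ => ?_
              refine mul_le_mul_of_nonneg_left ?_ (Finset.prod_nonneg fun i _ => hμ _)
              refine ite_one_zero_mono ?_
              rintro ⟨h1, h2⟩
              constructor
              · calc a ^ (k + 1) * #A = a ^ k * (a * #A) := by ring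
                  _ ≤ a ^ k * #(A.filter (fun x => h S x = y 0)) := by gcongr; exact hS.1
                  _ ≤ _ := h1
              · calc _ ≤ b ^ k * (#(A.filter (fun x => h S x = y 0)) : ℝ) := h2
                  _ ≤ b ^ k * (b * #A) := by gcongr; exact hS.2
                  _ = _ := by ring
          · rw [zero_mul]
            refine Finset.sum_nonneg fun Sv _ => ?_
            refine mul_nonneg (Finset.prod_nonneg fun i _ => hμ _) ?_
            split_ifs <;> norm_num

/-- The nontrivial real character of `ZMod 2`. -/
def signChar (a : ZMod 2) : ℝ := if a = 0 then 1 else -1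

theorem signChar_zero : signChar 0 = 1 := by simp [signChar]

theorem signChar_add (a b : ZMod 2) : signChar (a + b) = signChar a * signChar b := by
  have h : ∀ c : ZMod 2, c = 0 ∨ c = 1 := by decide
  rcases h a with rfl | rfl <;> rcases h b with rfl | rfl <;>
    simp [signChar, CharTwo.add_self_eq_zero]

theorem signChar_sum {ι : Type*} (s : Finset ι) (x : ι → ZMod 2) :
    signChar (∑ j ∈ s, x j) = ∏ j ∈ s, signChar (x j) := by
  classical
  induction s using Finset.induction_on with
  | empty => simp [signChar_zero]
  | insert a s ha ih => rw [Finset.sum_insert ha, Finset.prod_insert ha, signChar_add, ih]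

theorem signChar_add_eq_ite (a b : ZMod 2) : signChar (a + b) = if a = b then 1 else -1 := by
  simp only [signChar, CharTwo.add_eq_zero]

theorem abs_signChar (a : ZMod 2) : |signChar a| = 1 := by
  unfold signChar; split_ifs <;> simp

theorem ite_eq_signChar (a y : ZMod 2) :
    (if a = y then (1 : ℝ) else 0) = (1 + signChar y * signChar a) / 2 := by
  rw [← signChar_add, signChar_add_eq_ite]
  by_cases h : a = y
  · simp [h]
  · simp [h, Ne.symm h]

/-- The probability of `S` when each element is kept independently with probability `p`. -/
def bernoulliWeight {n : ℕ} (p : ℝ) (S : Finset (Fin n)) : ℝ :=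
  p ^ #S * (1 - p) ^ (n - #S)

theorem bernoulliWeight_nonneg {n : ℕ} {p : ℝ} (hp : 0 ≤ p) (hp1 : p ≤ 1)
    (S : Finset (Fin n)) : 0 ≤ bernoulliWeight p S :=
  mul_nonneg (pow_nonneg hp _) (pow_nonneg (sub_nonneg.2 hp1) _)

theorem sum_bernoulliWeight_mul_prod {n : ℕ} (p : ℝ) (z : Fin n → ℝ) :
    ∑ S : Finset (Fin n), bernoulliWeight p S * ∏ j ∈ S, z j = ∏ j, (p * z j + (1 - p)) := by
  rw [Finset.prod_add, Finset.powerset_univ]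
  refine Finset.sum_congr rfl fun S _ => ?_
  rw [Finset.prod_mul_distrib, Finset.prod_const, Finset.prod_const,
    ← Finset.compl_eq_univ_sdiff, Finset.card_compl, Fintype.card_fin, bernoulliWeight]
  ring

theorem sum_bernoulliWeight {n : ℕ} (p : ℝ) :
    ∑ S : Finset (Fin n), bernoulliWeight p S = 1 := by
  simpa using sum_bernoulliWeight_mul_prod p (fun _ : Fin n => (1 : ℝ))

theorem sum_bernoulliWeight_mul_sq {n : ℕ} (p : ℝ) (A : Finset (Fin n → ZMod 2)) :
    ∑ S : Finset (Fin n), bernoulliWeight p S * (∑ x ∈ A, signChar (∑ j ∈ S, x j)) ^ 2 =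
      ∑ x ∈ A, ∑ x' ∈ A, ∏ j, (if x j = x' j then 1 else 1 - 2 * p) := by
  have key : ∀ x x' : Fin n → ZMod 2,
      ∏ j, (if x j = x' j then (1 : ℝ) else 1 - 2 * p) =
      ∑ S : Finset (Fin n), bernoulliWeight p S *
        (signChar (∑ j ∈ S, x j) * signChar (∑ j ∈ S, x' j)) := by
    intro x x'
    simp_rw [← signChar_add, ← Finset.sum_add_distrib, signChar_sum]
    rw [sum_bernoulliWeight_mul_prod]
    refine Finset.prod_congr rfl fun j _ => ?_
    rw [signChar_add_eq_ite]
    split_ifs <;> ring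
  simp_rw [key]
  simp_rw [Finset.sum_comm (s := A) (t := Finset.univ)]
  refine Finset.sum_congr rfl fun S _ => ?_
  rw [sq, Finset.sum_mul_sum, Finset.mul_sum]
  refine Finset.sum_congr rfl fun x _ => ?_
  rw [Finset.mul_sum]

theorem sum_prod_ite_eq (n : ℕ) (x : Fin n → ZMod 2) (u : ℝ) :
    ∑ x' : Fin n → ZMod 2, ∏ j, (if x j = x' j then 1 else u) = (1 + u) ^ n := by
  have h := (Finset.prod_univ_sum (fun _ : Fin n => (Finset.univ : Finset (ZMod 2)))
    (fun j b => if x j = b then (1 : ℝ) else u)).symm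
  rw [Fintype.piFinset_univ] at h
  rw [h]
  have : ∀ a : ZMod 2, ∑ b : ZMod 2, (if a = b then (1 : ℝ) else u) = 1 + u := by
    intro a
    rw [show (Finset.univ : Finset (ZMod 2)) = {0, 1} from rfl, Finset.sum_pair (by decide)]
    have h2 : ∀ c : ZMod 2, c = 0 ∨ c = 1 := by decide
    rcases h2 a with rfl | rfl <;> simp [add_comm]
  simp [this]

/-- Jensen's inequality, for averages of Hamming-type kernels over a set. -/
theorem sum_prod_ite_le {n : ℕ} {u s v : ℝ} (hu : 0 ≤ u) (hs : 0 < s) (hs1 : s ≤ 1)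
    (hv : 0 ≤ v) (hvu : v ≤ u ^ s) (A : Finset (Fin n → ZMod 2)) (hA : A.Nonempty)
    (x : Fin n → ZMod 2) :
    ∑ x' ∈ A, ∏ j, (if x j = x' j then 1 else v) ≤ #A * ((1 + u) ^ n / #A) ^ s := by
  have hApos : (0 : ℝ) < #A := by exact_mod_cast hA.card_pos
  have hw : ∀ x' : Fin n → ZMod 2, 0 ≤ ∏ j, (if x j = x' j then 1 else u) := fun x' =>
    Finset.prod_nonneg fun j _ => by split_ifs <;> simp [hu]
  have hle : ∀ x' : Fin n → ZMod 2, ∏ j, (if x j = x' j then 1 else v) ≤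
      (∏ j, (if x j = x' j then 1 else u)) ^ s := by
    intro x'
    rw [← Real.finsetProd_rpow _ _ (fun j _ => by split_ifs <;> simp [hu])]
    refine Finset.prod_le_prod (fun j _ => by split_ifs <;> simp [hv]) fun j _ => ?_
    split_ifs <;> simp [hvu]
  have hJ := (Real.concaveOn_rpow hs.le hs1).le_map_sum (t := A) (w := fun _ => (#A : ℝ)⁻¹)
    (p := fun x' => ∏ j, (if x j = x' j then 1 else u)) (fun _ _ => by positivity)
    (by simp [hApos.ne']) (fun x' _ => hw x')
  simp only [smul_eq_mul, ← Finset.mul_sum] at hJ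
  have hmono : (#A : ℝ)⁻¹ * ∑ x' ∈ A, ∏ j, (if x j = x' j then 1 else u) ≤
      (1 + u) ^ n / #A := by
    rw [div_eq_inv_mul]
    gcongr
    rw [← sum_prod_ite_eq n x u]
    exact Finset.sum_le_sum_of_subset_of_nonneg (Finset.subset_univ A) fun x' _ _ => hw x'
  calc _ ≤ ∑ x' ∈ A, (∏ j, (if x j = x' j then 1 else u)) ^ s :=
        Finset.sum_le_sum fun x' _ => hle x'
    _ = #A * ((#A : ℝ)⁻¹ * ∑ x' ∈ A, (∏ j, (if x j = x' j then 1 else u)) ^ s) := by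
        field_simp
    _ ≤ #A * ((#A : ℝ)⁻¹ * ∑ x' ∈ A, ∏ j, (if x j = x' j then 1 else u)) ^ s := by
        gcongr
    _ ≤ _ := by
        have := mul_nonneg (inv_nonneg.2 hApos.le) (Finset.sum_nonneg fun x' (_ : x' ∈ A) => hw x')
        gcongr

/-- The second moment of the bias of a random parity on a set of size at least `2 ^ (τ n)`. -/
theorem sum_bernoulliWeight_mul_sq_le {n : ℕ} {p τ : ℝ} (hp : 0 < p) (hp2 : p ≤ 1 / 2)
    (hτ : 0 < τ) (hτ1 : τ ≤ 1) (A : Finset (Fin n → ZMod 2))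
    (hA : (2 : ℝ) ^ (τ * n) ≤ #A) :
    ∑ S : Finset (Fin n), bernoulliWeight p S * (∑ x ∈ A, signChar (∑ j ∈ S, x j)) ^ 2 ≤
      (#A : ℝ) ^ 2 * ((2 : ℝ) ^ (-(p * n * τ) / (2 * Real.logb 2 (512 / τ)))) ^ 4 := by
  have hApos : (0 : ℝ) < #A := lt_of_lt_of_le (by positivity) hA
  have hAne : A.Nonempty := by
    rw [← Finset.card_pos]; exact_mod_cast hApos
  have hl2 : 0 < Real.log 2 := Real.log_pos (by norm_num)
  set r := Real.log (512 / τ) with hr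
  have hr1 : 1 ≤ r := by
    rw [hr, Real.le_log_iff_exp_le (by positivity)]
    have h3 : Real.exp 1 ≤ 512 := by have := Real.exp_one_lt_d9; linarith
    refine h3.trans ?_
    rw [le_div_iff₀ hτ]; nlinarith
  have hr0 : 0 < r := by linarith
  have hexp : τ / 512 = Real.exp (-r) := by
    rw [Real.exp_neg, hr, Real.exp_log (by positivity), inv_div]
  have hs0 : 0 < 2 * p / r := by positivity
  have hs1 : 2 * p / r ≤ 1 := by rw [div_le_one hr0]; linarith
  have hv : 1 - 2 * p ≤ (τ / 512) ^ (2 * p / r) := by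
    rw [hexp, ← Real.exp_mul, show -r * (2 * p / r) = -(2 * p) by field_simp]
    have := Real.add_one_le_exp (-(2 * p)); linarith
  have hbase : (1 + τ / 512) ^ n / #A ≤ Real.exp (n * τ * (1 / 512 - Real.log 2)) := by
    have h1 : (1 + τ / 512) ^ n ≤ Real.exp (n * (τ / 512)) := by
      rw [Real.exp_nat_mul]
      gcongr
      have := Real.add_one_le_exp (τ / 512); linarith
    have h2 : Real.exp (Real.log 2 * (τ * n)) ≤ #A := by
      rwa [Real.rpow_def_of_pos (by norm_num)] at hA
    calc _ ≤ Real.exp (n * (τ / 512)) / Real.exp (Real.log 2 * (τ * n)) := by gcongr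
      _ = _ := by rw [← Real.exp_sub]; ring_nf
  have hfin : ((1 + τ / 512) ^ n / #A : ℝ) ^ (2 * p / r) ≤
      ((2 : ℝ) ^ (-(p * n * τ) / (2 * Real.logb 2 (512 / τ)))) ^ 4 := by
    calc _ ≤ (Real.exp (n * τ * (1 / 512 - Real.log 2))) ^ (2 * p / r) := by gcongr
      _ = Real.exp (n * τ * (1 / 512 - Real.log 2) * (2 * p / r)) := by
          rw [Real.exp_mul _ (2 * p / r)]
      _ ≤ Real.exp (-(2 * (p * n * τ) * (Real.log 2) ^ 2 / r)) := by
          rw [Real.exp_le_exp]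
          have h5 : 1 / 512 - Real.log 2 ≤ - (Real.log 2) ^ 2 := by
            have := Real.log_two_gt_d9
            have := Real.log_two_lt_d9
            nlinarith
          calc _ = (n * τ * (2 * p / r)) * (1 / 512 - Real.log 2) := by ring
            _ ≤ (n * τ * (2 * p / r)) * (- (Real.log 2) ^ 2) := by gcongr
            _ = _ := by ring
      _ = _ := by
          rw [Real.rpow_def_of_pos (by norm_num : (0 : ℝ) < 2), ← Real.exp_nat_mul, Real.logb,
            ← hr]
          congr 1
          push_cast
          field_simp
          ring
  rw [sum_bernoulliWeight_mul_sq]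
  calc _ ≤ ∑ x ∈ A, #A * ((1 + τ / 512) ^ n / #A : ℝ) ^ (2 * p / r) :=
        Finset.sum_le_sum fun x _ =>
          sum_prod_ite_le (by positivity) hs0 hs1 (by linarith) hv A hAne x
    _ = (#A : ℝ) ^ 2 * ((1 + τ / 512) ^ n / #A : ℝ) ^ (2 * p / r) := by
        rw [Finset.sum_const, nsmul_eq_mul]; ring
    _ ≤ _ := by gcongr

/-- A random parity with small second moment splits `A` into nearly equal parts
with high probability. -/
theorem le_sum_bernoulliWeight_splits {n : ℕ} {p δ V : ℝ} (hp : 0 ≤ p) (hp1 : p ≤ 1)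
    (hδ : 0 < δ) (A : Finset (Fin n → ZMod 2)) (hA : (0 : ℝ) < #A) (y : ZMod 2)
    (hV : ∑ S : Finset (Fin n), bernoulliWeight p S * (∑ x ∈ A, signChar (∑ j ∈ S, x j)) ^ 2 ≤
      (#A : ℝ) ^ 2 * V) :
    1 - V / δ ^ 2 ≤ ∑ S : Finset (Fin n), bernoulliWeight p S *
      (if (1 - δ) / 2 * #A ≤ #(A.filter (fun x => ∑ j ∈ S, x j = y)) ∧
        (#(A.filter (fun x => ∑ j ∈ S, x j = y)) : ℝ) ≤ (1 + δ) / 2 * #A then 1 else 0) := by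
  have hpt : ∀ S : Finset (Fin n),
      1 - (∑ x ∈ A, signChar (∑ j ∈ S, x j)) ^ 2 / (δ ^ 2 * (#A : ℝ) ^ 2) ≤
      (if (1 - δ) / 2 * #A ≤ #(A.filter (fun x => ∑ j ∈ S, x j = y)) ∧
        (#(A.filter (fun x => ∑ j ∈ S, x j = y)) : ℝ) ≤ (1 + δ) / 2 * #A then 1 else 0) := by
    intro S
    set b := ∑ x ∈ A, signChar (∑ j ∈ S, x j) with hb
    have hcard : (#(A.filter (fun x => ∑ j ∈ S, x j = y)) : ℝ) =
        (#A + signChar y * b) / 2 := by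
      rw [Finset.card_filter, Nat.cast_sum]
      push_cast
      simp_rw [ite_eq_signChar]
      rw [← Finset.sum_div, Finset.sum_add_distrib, ← Finset.mul_sum, ← hb]
      simp
    have habs : |signChar y * b| = |b| := by rw [abs_mul, abs_signChar, one_mul]
    split_ifs with h
    · have : 0 ≤ b ^ 2 / (δ ^ 2 * (#A : ℝ) ^ 2) := by positivity
      linarith
    · have hlt : δ * #A < |b| := by
        by_contra! hle
        rw [← habs, abs_le] at hle
        exact h (by rw [hcard]; constructor <;> linarith [hle.1, hle.2])
      rw [sub_nonpos, one_le_div (by positivity), ← mul_pow, ← sq_abs b]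
      gcongr
  calc 1 - V / δ ^ 2
      ≤ 1 - (∑ S : Finset (Fin n), bernoulliWeight p S *
          (∑ x ∈ A, signChar (∑ j ∈ S, x j)) ^ 2) / (δ ^ 2 * (#A : ℝ) ^ 2) := by
        gcongr 1 - ?_
        rw [div_le_div_iff₀ (by positivity) (by positivity)]
        calc _ ≤ (#A : ℝ) ^ 2 * V * δ ^ 2 := by gcongr
          _ = _ := by ring
    _ = ∑ S : Finset (Fin n), bernoulliWeight p S *
          (1 - (∑ x ∈ A, signChar (∑ j ∈ S, x j)) ^ 2 / (δ ^ 2 * (#A : ℝ) ^ 2)) := by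
        simp_rw [mul_sub, mul_one, Finset.sum_sub_distrib, sum_bernoulliWeight, Finset.sum_div,
          mul_div_assoc]
    _ ≤ _ := Finset.sum_le_sum fun S _ =>
        mul_le_mul_of_nonneg_left (hpt S) (bernoulliWeight_nonneg hp hp1 S)

theorem one_sub_le_one_sub_sq_pow {m : ℕ} (hm : 1 ≤ m) {ε : ℝ} (hε : 0 < ε) (hε1 : ε < 1) :
    1 - ε ≤ (1 - (ε / m) ^ 2) ^ m := by
  have hm' : (1 : ℝ) ≤ m := by exact_mod_cast hm
  have hle : ε / m ≤ 1 := by rw [div_le_one (by positivity)]; linarith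
  have h0 : 0 < ε / m := by positivity
  have hB := one_add_mul_le_pow (a := -(ε / m) ^ 2) (by nlinarith) m
  have h2 : (m : ℝ) * (ε / m) ^ 2 ≤ ε := by
    have : (m : ℝ) * (ε / m) ^ 2 = ε * (ε / m) := by field_simp
    rw [this]; nlinarith
  calc 1 - ε ≤ 1 + m * -(ε / m) ^ 2 := by linarith
    _ ≤ _ := hB
    _ = _ := by ring

theorem one_add_sq_pow_le {m : ℕ} (hm : 1 ≤ m) {ε : ℝ} (hε : 0 < ε) (hε1 : ε < 1) :
    (1 + (ε / m) ^ 2) ^ m ≤ 1 + ε := by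
  rcases hm.eq_or_lt with rfl | hm2
  · simp; nlinarith
  have hm' : (2 : ℝ) ≤ m := by exact_mod_cast hm2
  have h0 : 0 < ε / m := by positivity
  have hle : ε / m ≤ 1 / 2 := by
    rw [div_le_div_iff₀ (by positivity) (by norm_num)]; linarith
  have hB := one_add_mul_le_pow (a := -(ε / m) ^ 2) (by nlinarith) m
  have h1 : (1 + (ε / m) ^ 2) ^ m * (1 + -(ε / m) ^ 2) ^ m ≤ 1 := by
    rw [← mul_pow]
    have hd : (ε / m) ^ 2 ≤ 1 := pow_le_one₀ h0.le (by linarith)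
    exact pow_le_one₀ (mul_nonneg (by positivity) (by linarith))
      (by nlinarith [sq_nonneg ((ε / m) ^ 2)])
  have h2 : (m : ℝ) * (ε / m) ^ 2 = ε * (ε / m) := by field_simp
  have h3 : 1 ≤ (1 + ε) * (1 + m * -(ε / m) ^ 2) := by
    have h3' : ε * (ε / m) * (1 + ε) ≤ ε * (1 / 2) * 2 := by gcongr; linarith
    rw [mul_neg, h2]; linarith
  have h4 : 0 < 1 + (m : ℝ) * -(ε / m) ^ 2 := by
    rw [mul_neg, h2]; nlinarith
  have h5 : (1 + (ε / m) ^ 2) ^ m * (1 + m * -(ε / m) ^ 2) ≤ 1 :=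
    (mul_le_mul_of_nonneg_left hB (by positivity)).trans h1
  exact le_of_mul_le_mul_right (h5.trans h3) h4

theorem half_le_one_sub_sq_pow {m j : ℕ} (hj : j < m) {ε : ℝ} (hε : 0 < ε) (hε1 : ε < 1) :
    1 / 2 ≤ (1 - (ε / m) ^ 2) ^ j := by
  have hjm : (j : ℝ) + 1 ≤ m := by exact_mod_cast hj
  have hm0 : (0 : ℝ) < m := by have : (0 : ℝ) ≤ j := j.cast_nonneg; linarith
  have h0 : 0 < ε / m := by positivity
  have hle : ε / m ≤ 1 / m := by gcongr
  have hle1 : ε / m ≤ 1 := by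
    rw [div_le_one hm0]; have : (0 : ℝ) ≤ j := j.cast_nonneg; linarith
  have hB := one_add_mul_le_pow (a := -(ε / m) ^ 2) (by nlinarith) j
  have h2 : (j : ℝ) * (ε / m) ^ 2 ≤ 1 / 2 := by
    calc (j : ℝ) * (ε / m) ^ 2 ≤ (m - 1) * (1 / m) ^ 2 := by
          have hj1 : (j : ℝ) ≤ m - 1 := by linarith
          have hm1 : (0 : ℝ) ≤ m - 1 := j.cast_nonneg.trans hj1
          gcongr
      _ ≤ 1 / 2 := by
          rw [one_div, inv_pow, ← div_eq_mul_inv, div_le_div_iff₀ (by positivity) (by norm_num)]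
          nlinarith [sq_nonneg ((m : ℝ) - 1)]
  calc 1 / 2 ≤ 1 + j * -(ε / m) ^ 2 := by linarith
    _ ≤ _ := hB
    _ = _ := by ring

/-- Main Lemma for `ĥ`: if `P := (m/ε)·2^{−p·n·t̃₀/(2·log₂(512/t̃₀))} < 1`
and `t̃₀·n + m + 1 ≤ n`, then the Bernoulli(`p`) random linear hash function
`ĥ : {0,1}^n → {0,1}^m` is a `(t̃₀·n + m + 1, ε)`-hash function for flat distributions
with probability at least `(1−P)^m > 0`.

Here `ĥ` is given by choosing `S_1,...,S_m ∼ μ_p` independently with `ĥ_i(x) = ⊕_{j∈S_i}x_j`,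
and the hash-function property is spelled out: for every `y ∈ {0,1}^m` and every `t`-flat
distribution `f` with `t̃₀·n + m + 1 ≤ t ≤ n`, the probability (over the choice of the `S_i`)
that `|Pr_{x∼f}(ĥ(x)=y) − 2^{−m}| ≤ ε·2^{−m}` is at least `(1−P)^m`. -/
theorem stmt7 (n m : ℕ) (hn : 1 ≤ n) (hm : 1 ≤ m)
    (ε p tt0 : ℝ) (hε : 0 < ε) (hε1 : ε < 1) (hp : 0 < p) (hp2 : p ≤ 1 / 2)
    (htt0 : 0 < tt0) (htt01 : tt0 ≤ 1)
    (P : ℝ) (hPdef : P = ((m : ℝ) / ε) * (2 : ℝ) ^ (-(p * n * tt0) / (2 * Real.logb 2 (512 / tt0))))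
    (hP1 : P < 1) (hrange : tt0 * n + m + 1 ≤ (n : ℝ)) :
    0 < (1 - P) ^ m ∧
    ∀ (y : Fin m → ZMod 2) (t : ℝ), tt0 * n + m + 1 ≤ t → t ≤ (n : ℝ) →
      ∀ f : (Fin n → ZMod 2) → ℝ,
        (∀ x, 0 ≤ f x) → (∑ x : Fin n → ZMod 2, f x) = 1 →
        (∀ x, f x = 0 ∨ f x = (2 : ℝ) ^ (-t)) →
        (1 - P) ^ m ≤
          ∑ Sv : Fin m → Finset (Fin n),
            (∏ i : Fin m, p ^ (Sv i).card * (1 - p) ^ (n - (Sv i).card)) *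
              (if |(∑ x ∈ Finset.univ.filter
                      (fun x : Fin n → ZMod 2 => ∀ i : Fin m, (∑ j ∈ Sv i, x j) = y i), f x)
                    - (1 / 2 : ℝ) ^ m| ≤ ε * (1 / 2 : ℝ) ^ m then (1 : ℝ) else 0) := by
  have hmpos : (1 : ℝ) ≤ m := by exact_mod_cast hm
  have hP0 : 0 < P := by rw [hPdef]; positivity
  refine ⟨pow_pos (by linarith) m, ?_⟩
  intro y t ht _ f _ hf1 hflat
  set A : Finset (Fin n → ZMod 2) := Finset.univ.filter (fun x => f x ≠ 0) with hAdef
  have hfx : ∀ x, f x = if x ∈ A then (2 : ℝ) ^ (-t) else 0 := by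
    intro x
    rcases hflat x with h | h
    · simp [hAdef, h]
    · simp [hAdef, h]
  have hcount : ∀ s : Finset (Fin n → ZMod 2), ∑ x ∈ s, f x = #(s ∩ A) * (2 : ℝ) ^ (-t) := by
    intro s
    simp_rw [hfx]
    rw [Finset.sum_ite_mem, Finset.sum_const, nsmul_eq_mul]
  have hcard : (#A : ℝ) * (2 : ℝ) ^ (-t) = 1 := by
    rw [← hf1, hcount, Finset.univ_inter]
  have hA2 : (#A : ℝ) = (2 : ℝ) ^ t := by
    rw [Real.rpow_neg (by norm_num)] at hcard
    have : (0 : ℝ) < 2 ^ t := by positivity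
    field_simp at hcard
    linarith
  set δ : ℝ := (ε / m) ^ 2 with hδ
  have hem : ε / m ≤ 1 := by rw [div_le_one (by positivity)]; linarith
  have hem0 : 0 < ε / m := by positivity
  have hδ0 : 0 < δ := by positivity
  have hδ1 : δ ≤ 1 := pow_le_one₀ hem0.le hem
  have hmain := pow_le_sum_prod_of_splits (bernoulliWeight (n := n) p)
    (bernoulliWeight_nonneg hp.le (by linarith)) (fun S x => ∑ j ∈ S, x j)
    (a := (1 - δ) / 2) (b := (1 + δ) / 2) (c := 1 - P) (B := (2 : ℝ) ^ (tt0 * n))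
    (by linarith) (by linarith) (by linarith) ?_ m A y ?_
  · refine hmain.trans (Finset.sum_le_sum fun Sv _ => ?_)
    refine mul_le_mul_of_nonneg_left (ite_one_zero_mono ?_)
      (Finset.prod_nonneg fun i _ => bernoulliWeight_nonneg hp.le (by linarith) _)
    rintro ⟨h1, h2⟩
    have hinter : Finset.univ.filter
        (fun x : Fin n → ZMod 2 => ∀ i : Fin m, (∑ j ∈ Sv i, x j) = y i) ∩ A =
        A.filter (fun x => ∀ i : Fin m, (∑ j ∈ Sv i, x j) = y i) := by
      ext x; simp [and_comm]
    rw [hcount, hinter]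
    have hq : (0 : ℝ) < 2 ^ (-t) := by positivity
    have h1' := mul_le_mul_of_nonneg_right h1 hq.le
    have h2' := mul_le_mul_of_nonneg_right h2 hq.le
    rw [mul_assoc, hcard, mul_one, div_eq_mul_one_div, mul_pow] at h1' h2'
    have hh : (0 : ℝ) < (1 / 2) ^ m := by positivity
    have hlo := mul_le_mul_of_nonneg_right (one_sub_le_one_sub_sq_pow hm hε hε1) hh.le
    have hhi := mul_le_mul_of_nonneg_right (one_add_sq_pow_le hm hε hε1) hh.le
    rw [abs_le]
    constructor <;> linarith
  · intro A' y' hA'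
    have hpos : (0 : ℝ) < #A' := lt_of_lt_of_le (by positivity) hA'
    refine le_trans ?_ (le_sum_bernoulliWeight_splits hp.le (by linarith) hδ0 A' hpos y'
      (sum_bernoulliWeight_mul_sq_le hp hp2 htt0 htt01 A' hA'))
    have hP4 : ((2 : ℝ) ^ (-(p * n * tt0) / (2 * Real.logb 2 (512 / tt0)))) ^ 4 / δ ^ 2 =
        P ^ 4 := by
      rw [hPdef, hδ]
      field_simp
    rw [hP4]
    have : P ^ 4 ≤ P := pow_le_of_le_one hP0.le hP1.le (by norm_num)
    linarith
  · intro j hj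
    rw [hA2, div_eq_mul_one_div, mul_pow]
    have hpow : (1 / 2 : ℝ) ^ m ≤ (1 / 2) ^ j :=
      pow_le_pow_of_le_one (by norm_num) (by norm_num) hj.le
    calc (2 : ℝ) ^ (tt0 * n) = 1 / 2 * (1 / 2) ^ m * 2 ^ (tt0 * n + m + 1) := by
          rw [Real.rpow_add (by norm_num), Real.rpow_add (by norm_num), Real.rpow_one,
            Real.rpow_natCast, one_div, inv_pow]
          field_simp
      _ ≤ (1 - δ) ^ j * (1 / 2) ^ j * 2 ^ t := by
          have := half_le_one_sub_sq_pow hj hε hε1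
          have h1δ : 0 ≤ (1 - δ) ^ j := pow_nonneg (by linarith) j
          gcongr
          norm_num
end

section
/- Let 0 < p ≤ 1/2 and 0 < α ≤ 1, set c := 1 − αp and d₁ := 1 − 2p, and let d₂ be any real with max(A(α,p), (1−p)·4^{αp}) ≤ d₂. Then for all nonnegative reals x₀, x₁, y₀, y₁: (x₀y₀)^c + (x₁y₁)^c + d₁·((x₀y₁)^c + (x₁y₀)^c) ≤ d₂·((x₀+x₁)·(y₀+y₁))^c. -/
/-- `‖(a,b)‖_q = (|a|^q + |b|^q)^{1/q}`. -/
noncomputable def pairNorm (q a b : ℝ) : ℝ := (|a| ^ q + |b| ^ q) ^ (1 / q)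

/-- `A(α,p) = sup_{0≤x≤1} ‖(1−2px, 1−2p(1−x))‖_{1/(αp)} / ‖(x,1−x)‖_{1/(1−αp)}`. -/
noncomputable def Aconst (α p : ℝ) : ℝ :=
  sSup ((fun x : ℝ =>
      pairNorm (1 / (α * p)) (1 - 2 * p * x) (1 - 2 * p * (1 - x)) /
        pairNorm (1 / (1 - α * p)) x (1 - x)) '' Set.Icc 0 1)

theorem pairNorm_mul {q s : ℝ} (hq : 0 < q) (hs : 0 ≤ s) (a b : ℝ) :
    pairNorm q (s * a) (s * b) = s * pairNorm q a b := by
  unfold pairNorm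
  rw [abs_mul, abs_mul, abs_of_nonneg hs, Real.mul_rpow hs (abs_nonneg a),
    Real.mul_rpow hs (abs_nonneg b), ← mul_add, Real.mul_rpow (by positivity) (by positivity),
    ← Real.rpow_mul hs, mul_one_div_cancel hq.ne', Real.rpow_one]

theorem pairNorm_comm (q a b : ℝ) : pairNorm q a b = pairNorm q b a := by
  unfold pairNorm
  rw [add_comm]

theorem pairNorm_pos {q a b : ℝ} (h : a ≠ 0 ∨ b ≠ 0) : 0 < pairNorm q a b := by
  unfold pairNorm
  rcases h with h | h
  · have := Real.rpow_pos_of_pos (abs_pos.mpr h) q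
    positivity
  · have := Real.rpow_pos_of_pos (abs_pos.mpr h) q
    positivity

theorem Continuous.pairNorm {q : ℝ} (hq : 0 < q) {f g : ℝ → ℝ} (hf : Continuous f)
    (hg : Continuous g) : Continuous fun x => pairNorm q (f x) (g x) := by
  unfold _root_.pairNorm
  exact ((hf.abs.rpow_const fun _ => Or.inr hq.le).add
    (hg.abs.rpow_const fun _ => Or.inr hq.le)).rpow_const fun _ => Or.inr (by positivity)

/-- Hölder's inequality for pairs of reals. -/
theorem add_mul_le_pairNorm_mul_pairNorm {q r : ℝ} (hqr : q.HolderConjugate r) (a b u v : ℝ) :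
    a * u + b * v ≤ pairNorm q a b * pairNorm r u v := by
  have h := Real.inner_le_Lp_mul_Lq Finset.univ ![a, b] ![u, v] hqr
  simpa [pairNorm] using h

/-- The power `x ↦ x ^ c` turns the `1 / c`-norm of a pair into the power of its sum. -/
theorem pairNorm_rpow {c x y : ℝ} (hc : 0 < c) (hx : 0 ≤ x) (hy : 0 ≤ y) :
    pairNorm (1 / c) (x ^ c) (y ^ c) = (x + y) ^ c := by
  unfold pairNorm
  rw [abs_of_nonneg (by positivity), abs_of_nonneg (by positivity), ← Real.rpow_mul hx,
    ← Real.rpow_mul hy, mul_one_div_cancel hc.ne', Real.rpow_one, Real.rpow_one, one_div_one_div]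

theorem pairNorm_le_Aconst_mul {α p t : ℝ} (h0 : 0 < α * p) (h1 : 0 < 1 - α * p)
    (ht : t ∈ Set.Icc (0 : ℝ) 1) :
    pairNorm (1 / (α * p)) (1 - 2 * p * t) (1 - 2 * p * (1 - t)) ≤
      Aconst α p * pairNorm (1 / (1 - α * p)) t (1 - t) := by
  have hpos : ∀ x : ℝ, 0 < pairNorm (1 / (1 - α * p)) x (1 - x) := fun x => by
    apply pairNorm_pos
    by_contra! h
    linarith [h.1, h.2]
  rw [← div_le_iff₀ (hpos t)]
  refine le_csSup (isCompact_Icc.bddAbove_image (Continuous.continuousOn ?_)) ⟨t, ht, rfl⟩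
  exact (Continuous.pairNorm (by positivity) (by fun_prop) (by fun_prop)).div
    (Continuous.pairNorm (by positivity) (by fun_prop) (by fun_prop)) fun x => (hpos x).ne'

/-- `Aconst α p` bounds the symmetric matrix with diagonal `1` and off-diagonal `1 - 2p`,
as an operator between the two norms, on nonnegative vectors. -/
theorem pairNorm_matrix_le_Aconst_mul {α p a b : ℝ} (h0 : 0 < α * p) (h1 : 0 < 1 - α * p)
    (ha : 0 ≤ a) (hb : 0 ≤ b) (hab : 0 < a + b) :
    pairNorm (1 / (α * p)) (a + (1 - 2 * p) * b) (b + (1 - 2 * p) * a) ≤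
      Aconst α p * pairNorm (1 / (1 - α * p)) a b := by
  have ht : a / (a + b) ∈ Set.Icc (0 : ℝ) 1 :=
    ⟨by positivity, (div_le_one hab).mpr (by linarith)⟩
  have h := mul_le_mul_of_nonneg_left (pairNorm_le_Aconst_mul h0 h1 ht) hab.le
  rw [← pairNorm_mul (by positivity) hab.le, mul_left_comm,
    ← pairNorm_mul (by positivity) hab.le] at h
  have e1 : (a + b) * (a / (a + b)) = a := by field_simp
  have e2 : (a + b) * (1 - a / (a + b)) = b := by field_simp; ring
  have e3 : (a + b) * (1 - 2 * p * (a / (a + b))) = b + (1 - 2 * p) * a := by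
    linear_combination (-2 * p) * e1
  have e4 : (a + b) * (1 - 2 * p * (1 - a / (a + b))) = a + (1 - 2 * p) * b := by
    linear_combination (-2 * p) * e2
  rw [e1, e2, e3, e4, pairNorm_comm] at h
  exact h

/-- with `c = 1 − αp`, `d₁ = 1 − 2p`, and `max(A(α,p), (1−p)·4^{αp}) ≤ d₂`,
for all nonnegative reals `x₀, x₁, y₀, y₁`:
`(x₀y₀)^c + (x₁y₁)^c + d₁·((x₀y₁)^c + (x₁y₀)^c) ≤ d₂·((x₀+x₁)(y₀+y₁))^c`.
(Real powers; `0^c = 0` for `c > 0`.) -/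
theorem stmt12 (p α : ℝ) (hp : 0 < p) (hp2 : p ≤ 1 / 2) (hα : 0 < α) (hα1 : α ≤ 1)
    (c d₁ d₂ : ℝ) (hc : c = 1 - α * p) (hd₁ : d₁ = 1 - 2 * p)
    (hd₂ : max (Aconst α p) ((1 - p) * (4 : ℝ) ^ (α * p)) ≤ d₂)
    (x₀ x₁ y₀ y₁ : ℝ) (hx₀ : 0 ≤ x₀) (hx₁ : 0 ≤ x₁) (hy₀ : 0 ≤ y₀) (hy₁ : 0 ≤ y₁) :
    (x₀ * y₀) ^ c + (x₁ * y₁) ^ c + d₁ * ((x₀ * y₁) ^ c + (x₁ * y₀) ^ c)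
      ≤ d₂ * ((x₀ + x₁) * (y₀ + y₁)) ^ c := by
  have h0 : 0 < α * p := by positivity
  have hc0 : 0 < c := by nlinarith
  have h1 : 0 < 1 - α * p := hc ▸ hc0
  have hd0 : 0 ≤ d₁ := by linarith
  have hA : Aconst α p ≤ d₂ := (le_max_left _ _).trans hd₂
  rw [Real.mul_rpow hx₀ hy₀, Real.mul_rpow hx₁ hy₁, Real.mul_rpow hx₀ hy₁,
    Real.mul_rpow hx₁ hy₀, Real.mul_rpow (by positivity) (by positivity)]
  rcases (add_nonneg hx₀ hx₁).eq_or_lt with hx | hx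
  · obtain rfl : x₀ = 0 := by linarith
    obtain rfl : x₁ = 0 := by linarith
    simp [Real.zero_rpow hc0.ne']
  have hab : 0 < x₀ ^ c + x₁ ^ c := by
    rcases hx₀.eq_or_lt with h | h
    · have := Real.rpow_pos_of_pos (show 0 < x₁ by linarith) c
      positivity
    · have := Real.rpow_pos_of_pos h c
      positivity
  have hconj : (1 / c).HolderConjugate (1 / (α * p)) := by
    rw [Real.holderConjugate_iff]
    refine ⟨(one_lt_div hc0).mpr (by linarith), ?_⟩
    simp only [one_div, inv_inv]
    linarith
  have hM := pairNorm_matrix_le_Aconst_mul h0 h1 (Real.rpow_nonneg hx₀ c)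
    (Real.rpow_nonneg hx₁ c) hab
  rw [← hd₁, ← hc, pairNorm_rpow hc0 hx₀ hx₁] at hM
  calc x₀ ^ c * y₀ ^ c + x₁ ^ c * y₁ ^ c + d₁ * (x₀ ^ c * y₁ ^ c + x₁ ^ c * y₀ ^ c)
      = y₀ ^ c * (x₀ ^ c + d₁ * x₁ ^ c) + y₁ ^ c * (x₁ ^ c + d₁ * x₀ ^ c) := by ring
    _ ≤ pairNorm (1 / c) (y₀ ^ c) (y₁ ^ c) *
        pairNorm (1 / (α * p)) (x₀ ^ c + d₁ * x₁ ^ c) (x₁ ^ c + d₁ * x₀ ^ c) :=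
      add_mul_le_pairNorm_mul_pairNorm hconj _ _ _ _
    _ ≤ (y₀ + y₁) ^ c * (d₂ * (x₀ + x₁) ^ c) := by
      rw [pairNorm_rpow hc0 hy₀ hy₁]
      gcongr
      exact hM.trans (by gcongr)
    _ = d₂ * ((x₀ + x₁) ^ c * (y₀ + y₁) ^ c) := by ring
end

section
/- Let n ≥ 1, let t ≥ 0 be such that s := 2^t is an integer in {1,...,2^n}, let f : {0,1}^n → ℝ be a t-flat distribution, let 0 < p ≤ 1/2 and 0 < α ≤ 1/9. Then E_{S∼μ_p}[|f̃(S)|] ≤ (1/2) · exp((1/2)·2^{−1/α+8}·α·p·n) · s^{−αp}. -/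
open Finset

/-- The Fourier coefficient `f̂(S) = E_{x uniform on {0,1}^n}[f(x)·(−1)^{⊕_{i∈S} x_i}]`. -/
noncomputable def fhatCoeff {n : ℕ} (f : (Fin n → ZMod 2) → ℝ) (S : Finset (Fin n)) : ℝ :=
  (∑ x : Fin n → ZMod 2, f x * (if (∑ i ∈ S, x i) = 0 then (1 : ℝ) else -1)) / 2 ^ n

/-- The normalized Fourier coefficient `f̃(S) = 2^{n−1}·f̂(S)`. -/
noncomputable def ntildeCoeff {n : ℕ} (f : (Fin n → ZMod 2) → ℝ) (S : Finset (Fin n)) : ℝ :=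
  2 ^ (n - 1) * fhatCoeff f S

/-- The sign `(-1) ^ a` of a bit `a`. -/
noncomputable def bitSign (a : ZMod 2) : ℝ := if a = 0 then 1 else -1

/-- The product kernel `ρ ^ d(x, y)`, with `d` the Hamming distance on the cube. -/
noncomputable def noiseKernel {n : ℕ} (ρ : ℝ) (x y : Fin n → ZMod 2) : ℝ :=
  ∏ i, if x i = y i then 1 else ρ

lemma zmod_two_eq_zero_or_one : ∀ a : ZMod 2, a = 0 ∨ a = 1 := by decide

lemma bitSign_add (a b : ZMod 2) : bitSign (a + b) = bitSign a * bitSign b := by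
  unfold bitSign
  have h2 : (1 : ZMod 2) + 1 = 0 := by decide
  rcases zmod_two_eq_zero_or_one a with rfl | rfl <;>
    rcases zmod_two_eq_zero_or_one b with rfl | rfl <;> simp [h2]

lemma bitSign_mul_bitSign (a b : ZMod 2) : bitSign a * bitSign b = if a = b then 1 else -1 := by
  unfold bitSign
  rcases zmod_two_eq_zero_or_one a with rfl | rfl <;>
    rcases zmod_two_eq_zero_or_one b with rfl | rfl <;> simp

lemma bitSign_sum {n : ℕ} (x : Fin n → ZMod 2) (S : Finset (Fin n)) :
    bitSign (∑ i ∈ S, x i) = ∏ i ∈ S, bitSign (x i) := by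
  classical
  induction S using Finset.induction_on with
  | empty => simp [bitSign]
  | insert i S hi ih => rw [sum_insert hi, prod_insert hi, bitSign_add, ih]

lemma ntildeCoeff_eq {n : ℕ} (hn : 1 ≤ n) (f : (Fin n → ZMod 2) → ℝ) (S : Finset (Fin n)) :
    ntildeCoeff f S = 1 / 2 * ∑ x, f x * ∏ i ∈ S, bitSign (x i) := by
  obtain ⟨m, rfl⟩ : ∃ m, n = m + 1 := ⟨n - 1, by omega⟩
  simp only [← bitSign_sum]
  simp only [ntildeCoeff, fhatCoeff, bitSign, Nat.add_sub_cancel, pow_succ]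
  field_simp

lemma sum_biased_character_mul {n : ℕ} (p : ℝ) (x y : Fin n → ZMod 2) :
    ∑ S : Finset (Fin n), p ^ S.card * (1 - p) ^ (n - S.card) *
      ((∏ i ∈ S, bitSign (x i)) * ∏ i ∈ S, bitSign (y i)) = noiseKernel (1 - 2 * p) x y := by
  have h := Fintype.prod_add (fun i : Fin n => p * (bitSign (x i) * bitSign (y i)))
    (fun _ => 1 - p)
  have h2 : noiseKernel (1 - 2 * p) x y
      = ∏ i, (p * (bitSign (x i) * bitSign (y i)) + (1 - p)) := by
    refine prod_congr rfl fun i _ => ?_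
    rw [bitSign_mul_bitSign]
    split_ifs <;> ring
  rw [h2, h]
  refine sum_congr rfl fun S _ => ?_
  rw [prod_mul_distrib, prod_mul_distrib, prod_const, prod_const, card_compl, Fintype.card_fin]
  ring

lemma sum_biased_sq {n : ℕ} (p : ℝ) (f : (Fin n → ZMod 2) → ℝ) :
    ∑ S : Finset (Fin n), p ^ S.card * (1 - p) ^ (n - S.card) *
      (∑ x, f x * ∏ i ∈ S, bitSign (x i)) ^ 2
      = ∑ x, ∑ y, f x * f y * noiseKernel (1 - 2 * p) x y := by
  simp only [← sum_biased_character_mul, mul_sum, sq, sum_mul]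
  rw [sum_comm]
  refine sum_congr rfl fun x _ => ?_
  rw [sum_comm]
  refine sum_congr rfl fun y _ => sum_congr rfl fun S _ => ?_
  ring

lemma noiseKernel_nonneg {n : ℕ} {ρ : ℝ} (hρ : 0 ≤ ρ) (x y : Fin n → ZMod 2) :
    0 ≤ noiseKernel ρ x y :=
  prod_nonneg fun i _ => by split_ifs <;> positivity

lemma noiseKernel_le_rpow {n : ℕ} {ρ r c : ℝ} (hρ : 0 ≤ ρ) (hr : 0 ≤ r) (h : ρ ≤ r ^ c)
    (x y : Fin n → ZMod 2) : noiseKernel ρ x y ≤ noiseKernel r x y ^ c := by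
  unfold noiseKernel
  rw [← Real.finsetProd_rpow _ _ fun i _ => by split_ifs <;> positivity]
  refine prod_le_prod (fun i _ => by split_ifs <;> positivity) fun i _ => ?_
  split_ifs
  · simp
  · exact h

lemma sum_noiseKernel {n : ℕ} (r : ℝ) (x : Fin n → ZMod 2) :
    ∑ y, noiseKernel r x y = (1 + r) ^ n := by
  have h := prod_univ_sum (fun _ : Fin n => (univ : Finset (ZMod 2)))
    (fun i a => if x i = a then (1 : ℝ) else r)
  rw [Fintype.piFinset_univ] at h
  unfold noiseKernel
  rw [← h]
  have h1 (a : ZMod 2) : ∑ b : ZMod 2, (if a = b then (1 : ℝ) else r) = 1 + r := by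
    have hu : (univ : Finset (ZMod 2)) = {0, 1} := by decide
    rw [hu, sum_pair zero_ne_one]
    rcases zmod_two_eq_zero_or_one a with rfl | rfl <;> simp [add_comm]
  simp [h1]

lemma sum_sum_noiseKernel_le {n : ℕ} {f : (Fin n → ZMod 2) → ℝ} {M r : ℝ}
    (hf_nonneg : ∀ x, 0 ≤ f x) (hf_sum : ∑ x, f x = 1) (hf_le : ∀ x, f x ≤ M) (hr : 0 ≤ r) :
    ∑ x, ∑ y, f x * f y * noiseKernel r x y ≤ M * (1 + r) ^ n := by
  calc ∑ x, ∑ y, f x * f y * noiseKernel r x y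
      ≤ ∑ x, ∑ y, f x * (M * noiseKernel r x y) := by
        refine sum_le_sum fun x _ => sum_le_sum fun y _ => ?_
        rw [mul_assoc]
        exact mul_le_mul_of_nonneg_left (mul_le_mul_of_nonneg_right (hf_le y)
          (noiseKernel_nonneg hr x y)) (hf_nonneg x)
    _ = M * (1 + r) ^ n := by
        simp only [← mul_sum, sum_noiseKernel, ← sum_mul, hf_sum, one_mul]

/-- Jensen's inequality for the noise kernel of a distribution. -/
lemma sum_sum_noiseKernel_le_rpow {n : ℕ} {f : (Fin n → ZMod 2) → ℝ} {ρ r c : ℝ}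
    (hf_nonneg : ∀ x, 0 ≤ f x) (hf_sum : ∑ x, f x = 1) (hρ : 0 ≤ ρ) (hr : 0 ≤ r)
    (hc : 0 ≤ c) (hc1 : c ≤ 1) (h : ρ ≤ r ^ c) :
    ∑ x, ∑ y, f x * f y * noiseKernel ρ x y
      ≤ (∑ x, ∑ y, f x * f y * noiseKernel r x y) ^ c := by
  have hJ := (Real.concaveOn_rpow hc hc1).le_map_sum
    (t := (univ : Finset ((Fin n → ZMod 2) × (Fin n → ZMod 2))))
    (w := fun z => f z.1 * f z.2) (p := fun z => noiseKernel r z.1 z.2)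
    (fun z _ => mul_nonneg (hf_nonneg _) (hf_nonneg _))
    (by simp only [Fintype.sum_prod_type, ← mul_sum, hf_sum, mul_one])
    (fun z _ => noiseKernel_nonneg hr _ _)
  simp only [Fintype.sum_prod_type, smul_eq_mul] at hJ
  refine le_trans (sum_le_sum fun x _ => sum_le_sum fun y _ => ?_) hJ
  exact mul_le_mul_of_nonneg_left (noiseKernel_le_rpow hρ hr h x y)
    (mul_nonneg (hf_nonneg _) (hf_nonneg _))

lemma sq_sum_mul_abs_le {ι : Type*} {I : Finset ι} {w g : ι → ℝ} (hw : ∀ i ∈ I, 0 ≤ w i)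
    (hw_sum : ∑ i ∈ I, w i = 1) : (∑ i ∈ I, w i * |g i|) ^ 2 ≤ ∑ i ∈ I, w i * g i ^ 2 := by
  simpa using Real.pow_arith_mean_le_arith_mean_pow I w (fun i => |g i|) hw hw_sum
    (fun i _ => abs_nonneg _) 2

lemma one_sub_two_mul_le_rpow {p α : ℝ} (hp : 0 ≤ p) (hα : 0 < α) :
    1 - 2 * p ≤ ((2 : ℝ) ^ (-1 / α)) ^ (2 * (α * p)) := by
  have h : -1 / α * (2 * (α * p)) = -(2 * p) := by field_simp
  rw [← Real.rpow_mul zero_le_two, h, Real.rpow_def_of_pos zero_lt_two]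
  have h1 := Real.add_one_le_exp (Real.log 2 * -(2 * p))
  have h2 : Real.log 2 ≤ 1 := by linarith [Real.log_two_lt_d9]
  nlinarith

/-- if `f` is a `t`-flat distribution on `{0,1}^n` with `s := 2^t` an integer
in `{1,...,2^n}`, `0 < p ≤ 1/2` and `0 < α ≤ 1/9`, then
`E_{S∼μ_p}[|f̃(S)|] ≤ (1/2)·exp((1/2)·2^{−1/α+8}·α·p·n)·s^{−αp}`. -/
theorem stmt14 (n : ℕ) (hn : 1 ≤ n) (t : ℝ) (ht : 0 ≤ t) (s : ℝ) (hs : s = (2 : ℝ) ^ t)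
    (hpow : ∃ si : ℕ, 1 ≤ si ∧ si ≤ 2 ^ n ∧ (si : ℝ) = s)
    (f : (Fin n → ZMod 2) → ℝ)
    (hf_nonneg : ∀ x, 0 ≤ f x) (hf_sum : ∑ x : Fin n → ZMod 2, f x = 1)
    (hf_flat : ∀ x, f x = 0 ∨ f x = (2 : ℝ) ^ (-t))
    (p α : ℝ) (hp : 0 < p) (hp2 : p ≤ 1 / 2) (hα : 0 < α) (hα9 : α ≤ 1 / 9) :
    (∑ S : Finset (Fin n), p ^ S.card * (1 - p) ^ (n - S.card) * |ntildeCoeff f S|)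
      ≤ 1 / 2 * Real.exp (1 / 2 * (2 : ℝ) ^ (-1 / α + 8) * α * p * n) * s ^ (-(α * p)) := by
  have hs0 : 0 < s := hs ▸ Real.rpow_pos_of_pos zero_lt_two t
  have hf_le : ∀ x, f x ≤ s⁻¹ := fun x => by
    rcases hf_flat x with h | h
    · rw [h]; positivity
    · rw [h, hs, Real.rpow_neg zero_le_two]
  set r : ℝ := (2 : ℝ) ^ (-1 / α) with hr_def
  have hr : 0 < r := Real.rpow_pos_of_pos zero_lt_two _
  have hαp : 0 < α * p := mul_pos hα hp
  set g : Finset (Fin n) → ℝ := fun S => ∑ x, f x * ∏ i ∈ S, bitSign (x i)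
  set B : ℝ := Real.exp (α * p * (r * n)) * s ^ (-(α * p)) with hB
  have hw_sum : ∑ S : Finset (Fin n), p ^ S.card * (1 - p) ^ (n - S.card) = 1 := by
    simpa using Fintype.sum_pow_mul_eq_add_pow (Fin n) p (1 - p)
  have hB_sq : (s⁻¹ * (Real.exp r) ^ n) ^ (2 * (α * p)) = B ^ 2 := by
    rw [hB, mul_pow, Real.mul_rpow (by positivity) (by positivity), Real.inv_rpow hs0.le,
      ← Real.rpow_neg hs0.le, ← Real.exp_nat_mul, ← Real.exp_mul, ← Real.exp_nat_mul,
      ← Real.rpow_mul_natCast hs0.le, mul_comm]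
    congr 2 <;> push_cast <;> ring
  have hmain : ∑ S : Finset (Fin n), p ^ S.card * (1 - p) ^ (n - S.card) * |g S| ≤ B := by
    refine le_of_sq_le_sq ?_ (by positivity)
    calc _ ≤ ∑ S : Finset (Fin n), p ^ S.card * (1 - p) ^ (n - S.card) * g S ^ 2 :=
          sq_sum_mul_abs_le (fun S _ => mul_nonneg (by positivity)
            (pow_nonneg (by linarith) _)) hw_sum
      _ = ∑ x, ∑ y, f x * f y * noiseKernel (1 - 2 * p) x y := sum_biased_sq p f
      _ ≤ (∑ x, ∑ y, f x * f y * noiseKernel r x y) ^ (2 * (α * p)) :=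
          sum_sum_noiseKernel_le_rpow hf_nonneg hf_sum (by linarith) hr.le (by positivity)
            (by nlinarith) (one_sub_two_mul_le_rpow hp.le hα)
      _ ≤ (s⁻¹ * (Real.exp r) ^ n) ^ (2 * (α * p)) := by
          refine Real.rpow_le_rpow (sum_nonneg fun x _ => sum_nonneg fun y _ =>
            mul_nonneg (mul_nonneg (hf_nonneg x) (hf_nonneg y)) (noiseKernel_nonneg hr.le x y))
            ((sum_sum_noiseKernel_le hf_nonneg hf_sum hf_le hr.le).trans ?_) (by positivity)
          gcongr
          linarith [Real.add_one_le_exp r]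
      _ = B ^ 2 := hB_sq
  have hB_le : B ≤ Real.exp (1 / 2 * (2 : ℝ) ^ (-1 / α + 8) * α * p * n) * s ^ (-(α * p)) := by
    have h8 : (2 : ℝ) ^ (-1 / α + 8) = r * 256 := by
      rw [Real.rpow_add zero_lt_two, ← hr_def]
      norm_num
    rw [hB, h8]
    refine mul_le_mul_of_nonneg_right (Real.exp_le_exp.mpr ?_) (by positivity)
    have : 0 ≤ α * p * (r * n) := by positivity
    linarith
  have hterm : ∀ S : Finset (Fin n), p ^ S.card * (1 - p) ^ (n - S.card) * |ntildeCoeff f S|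
      = 1 / 2 * (p ^ S.card * (1 - p) ^ (n - S.card) * |g S|) := fun S => by
    rw [ntildeCoeff_eq hn, abs_mul, abs_of_pos (by norm_num : (0 : ℝ) < 1 / 2)]
    ring
  rw [sum_congr rfl fun S _ => hterm S, ← mul_sum, mul_assoc]
  exact mul_le_mul_of_nonneg_left (hmain.trans hB_le) (by norm_num)
end

section
/- Let n ≥ 1, let t ≥ 0 be such that 2^t is an integer in {1,...,2^n}, let f : {0,1}^n → ℝ be a t-flat distribution, set q := 2^{−(n−t)} (so q = Pr_{x uniform}(f(x) ≠ 0)), let 0 ≤ k ≤ n be an integer and 0 < δ ≤ 1. Then ∑_{S ⊆ {1,...,n}, |S| = k} f̃(S)² ≤ (2q)^{−2} · δ^{−k} · q^{2/(1+δ)}. -/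
open Finset

theorem two_le_add_rpow_neg {y e : ℝ} (hy0 : 0 ≤ y) (hy1 : y < 1) (he : e ≤ 0) :
    2 ≤ (1 + y) ^ e + (1 - y) ^ e := by
  have hu : 0 < (1 + y) ^ e := Real.rpow_pos_of_pos (by linarith) _
  have hv : 0 < (1 - y) ^ e := Real.rpow_pos_of_pos (by linarith) _
  have huv : 1 ≤ (1 + y) ^ e * (1 - y) ^ e := by
    rw [← Real.mul_rpow (by linarith) (by linarith)]
    exact Real.one_le_rpow_of_pos_of_le_one_of_nonpos (by nlinarith) (by nlinarith) he
  nlinarith [sq_nonneg ((1 + y) ^ e - (1 - y) ^ e)]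

theorem two_mul_mul_le_rpow_sub_rpow {y δ : ℝ} (hδ : 0 < δ) (hδ1 : δ ≤ 1)
    (hy0 : 0 ≤ y) (hy1 : y < 1) : 2 * δ * y ≤ (1 + y) ^ δ - (1 - y) ^ δ := by
  have hd : ∀ x ∈ Set.Ico (0 : ℝ) 1, HasDerivAt
      (fun x : ℝ => (1 + x) ^ δ - (1 - x) ^ δ - 2 * δ * x)
      (1 * δ * (1 + x) ^ (δ - 1) - (-1) * δ * (1 - x) ^ (δ - 1) - 2 * δ * 1) x := by
    intro x hx
    have h1 : HasDerivAt (fun x : ℝ => 1 + x) 1 x := (hasDerivAt_id x).const_add 1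
    have h2 : HasDerivAt (fun x : ℝ => 1 - x) (-1) x := (hasDerivAt_id x).const_sub 1
    exact ((h1.rpow_const (Or.inl (by linarith [hx.1]))).sub
      (h2.rpow_const (Or.inl (by linarith [hx.2])))).sub ((hasDerivAt_id x).const_mul (2 * δ))
  have hm : MonotoneOn (fun x : ℝ => (1 + x) ^ δ - (1 - x) ^ δ - 2 * δ * x) (Set.Ico 0 1) := by
    refine monotoneOn_of_deriv_nonneg (convex_Ico 0 1)
      (fun x hx => (hd x hx).continuousAt.continuousWithinAt)
      (fun x hx => (hd x (interior_subset hx)).differentiableAt.differentiableWithinAt) ?_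
    intro x hx
    have hx' := interior_subset hx
    rw [(hd x hx').deriv]
    nlinarith [two_le_add_rpow_neg hx'.1 hx'.2 (by linarith : δ - 1 ≤ 0)]
  have := hm (Set.left_mem_Ico.2 one_pos) ⟨hy0, hy1⟩ hy0
  norm_num at this
  linarith

theorem one_add_mul_sq_le_rpow_mean {y δ : ℝ} (hδ : 0 < δ) (hδ1 : δ ≤ 1)
    (hy0 : 0 ≤ y) (hy1 : y ≤ 1) :
    1 + (1 + δ) * δ / 2 * y ^ 2 ≤ ((1 + y) ^ (1 + δ) + (1 - y) ^ (1 + δ)) / 2 := by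
  have hd : ∀ x : ℝ, HasDerivAt
      (fun x : ℝ => (1 + x) ^ (1 + δ) + (1 - x) ^ (1 + δ) - (1 + δ) * δ * x ^ 2)
      (1 * (1 + δ) * (1 + x) ^ (1 + δ - 1) + (-1) * (1 + δ) * (1 - x) ^ (1 + δ - 1)
        - (1 + δ) * δ * (2 * x)) x := by
    intro x
    have h1 : HasDerivAt (fun x : ℝ => 1 + x) 1 x := (hasDerivAt_id x).const_add 1
    have h2 : HasDerivAt (fun x : ℝ => 1 - x) (-1) x := (hasDerivAt_id x).const_sub 1
    have h3 : HasDerivAt (fun x : ℝ => x ^ 2) (2 * x) x := by simpa using hasDerivAt_pow 2 x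
    exact ((h1.rpow_const (Or.inr (by linarith))).add
      (h2.rpow_const (Or.inr (by linarith)))).sub (h3.const_mul _)
  have hm : MonotoneOn
      (fun x : ℝ => (1 + x) ^ (1 + δ) + (1 - x) ^ (1 + δ) - (1 + δ) * δ * x ^ 2)
      (Set.Icc 0 1) := by
    refine monotoneOn_of_deriv_nonneg (convex_Icc 0 1)
      (fun x hx => (hd x).continuousAt.continuousWithinAt)
      (fun x hx => (hd x).differentiableAt.differentiableWithinAt) ?_
    intro x hx
    rw [interior_Icc] at hx
    rw [(hd x).deriv, add_sub_cancel_left]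
    nlinarith [two_mul_mul_le_rpow_sub_rpow hδ hδ1 hx.1.le hx.2]
  have := hm (Set.left_mem_Icc.2 zero_le_one) ⟨hy0, hy1⟩ hy0
  norm_num at this
  linarith

theorem two_point_of_le {a b δ : ℝ} (hδ : 0 < δ) (hδ1 : δ ≤ 1) (hb : 0 ≤ b) (hab : b ≤ a) :
    ((a + b) / 2) ^ 2 + δ * ((a - b) / 2) ^ 2
      ≤ ((a ^ (1 + δ) + b ^ (1 + δ)) / 2) ^ (2 / (1 + δ)) := by
  have hp : 0 < 1 + δ := by linarith
  rcases (add_nonneg (hb.trans hab) hb).eq_or_lt with h0 | h0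
  · have ha0 : a = 0 := by linarith
    have hb0 : b = 0 := by linarith
    subst ha0 hb0
    simp only [add_zero, sub_zero, zero_div]
    norm_num
    positivity
  set m := (a + b) / 2 with hm
  set y := (a - b) / (a + b) with hy
  have hm0 : 0 < m := by positivity
  have hy0 : 0 ≤ y := div_nonneg (by linarith) h0.le
  have hy1 : y ≤ 1 := (div_le_one h0).2 (by linarith)
  have ha : a = m * (1 + y) := by rw [hm, hy]; field_simp; ring
  have hb' : b = m * (1 - y) := by rw [hm, hy]; field_simp; ring
  have hsub : (a - b) / 2 = m * y := by rw [hm, hy]; field_simp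
  have hmean : (a ^ (1 + δ) + b ^ (1 + δ)) / 2
      = m ^ (1 + δ) * (((1 + y) ^ (1 + δ) + (1 - y) ^ (1 + δ)) / 2) := by
    conv_lhs => rw [ha, hb', Real.mul_rpow hm0.le (by linarith),
      Real.mul_rpow hm0.le (by linarith)]
    ring
  have hbern : (1 + δ * y ^ 2) ^ ((1 + δ) / 2)
      ≤ ((1 + y) ^ (1 + δ) + (1 - y) ^ (1 + δ)) / 2 := by
    refine le_trans ?_ (one_add_mul_sq_le_rpow_mean hδ hδ1 hy0 hy1)
    refine (rpow_one_add_le_one_add_mul_self (by nlinarith [sq_nonneg y]) (by linarith)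
      (by linarith)).trans (le_of_eq (by ring))
  have hone : 1 + δ * y ^ 2
      ≤ (((1 + y) ^ (1 + δ) + (1 - y) ^ (1 + δ)) / 2) ^ (2 / (1 + δ)) := by
    calc 1 + δ * y ^ 2 = ((1 + δ * y ^ 2) ^ ((1 + δ) / 2)) ^ (2 / (1 + δ)) := by
          rw [← Real.rpow_mul (by positivity), div_mul_div_cancel₀ two_ne_zero, div_self hp.ne',
            Real.rpow_one]
      _ ≤ _ := Real.rpow_le_rpow (by positivity) hbern (by positivity)
  rw [hmean, Real.mul_rpow (by positivity) (le_trans (by positivity) hbern),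
    ← Real.rpow_mul hm0.le, mul_div_cancel₀ _ hp.ne', Real.rpow_two, hsub]
  nlinarith [mul_le_mul_of_nonneg_left hone (sq_nonneg m)]

/-- The two-point Bonami inequality. -/
theorem two_point_inequality {a b δ : ℝ} (hδ : 0 < δ) (hδ1 : δ ≤ 1) (ha : 0 ≤ a) (hb : 0 ≤ b) :
    ((a + b) / 2) ^ 2 + δ * ((a - b) / 2) ^ 2
      ≤ ((a ^ (1 + δ) + b ^ (1 + δ)) / 2) ^ (2 / (1 + δ)) := by
  rcases le_total b a with h | h
  · exact two_point_of_le hδ hδ1 hb h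
  · have := two_point_of_le hδ hδ1 ha h
    rw [add_comm b a, add_comm (b ^ (1 + δ))] at this
    nlinarith

theorem sum_cube_succ {n : ℕ} (G : (Fin (n + 1) → ZMod 2) → ℝ) :
    ∑ x, G x = ∑ x : Fin n → ZMod 2, G (Fin.cons 0 x) + ∑ x : Fin n → ZMod 2, G (Fin.cons 1 x) := by
  rw [← (Fin.consEquiv fun _ : Fin (n + 1) => ZMod 2).sum_comp, Fintype.sum_prod_type]
  exact Fin.sum_univ_two _

theorem fhatCoeff_map_succ {n : ℕ} (f : (Fin (n + 1) → ZMod 2) → ℝ) (S : Finset (Fin n)) :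
    fhatCoeff f (S.map (Fin.succEmb n))
      = (fhatCoeff (fun x => f (Fin.cons 0 x)) S + fhatCoeff (fun x => f (Fin.cons 1 x)) S) / 2 := by
  unfold fhatCoeff
  rw [sum_cube_succ]
  simp only [Finset.sum_map, Fin.coe_succEmb, Fin.cons_succ]
  ring

theorem fhatCoeff_insert_zero_map_succ {n : ℕ} (f : (Fin (n + 1) → ZMod 2) → ℝ)
    (S : Finset (Fin n)) :
    fhatCoeff f (insert 0 (S.map (Fin.succEmb n)))
      = (fhatCoeff (fun x => f (Fin.cons 0 x)) S - fhatCoeff (fun x => f (Fin.cons 1 x)) S) / 2 := by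
  have hsign : ∀ a : ZMod 2, (if 1 + a = 0 then (1 : ℝ) else -1) = -(if a = 0 then 1 else -1) := by
    intro a
    have ha : a = 0 ∨ a = 1 := by
      revert a
      decide
    rcases ha with rfl | rfl
    · simp
    · simp [show (1 : ZMod 2) + 1 = 0 from rfl]
  have h0 : (0 : Fin (n + 1)) ∉ S.map (Fin.succEmb n) := by simp [Fin.succ_ne_zero]
  unfold fhatCoeff
  rw [sum_cube_succ]
  simp only [Finset.sum_insert h0, Finset.sum_map, Fin.coe_succEmb, Fin.cons_succ, Fin.cons_zero,
    zero_add, hsign, mul_neg, Finset.sum_neg_distrib]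
  ring

theorem sum_finset_fin_succ {n : ℕ} (G : Finset (Fin (n + 1)) → ℝ) :
    ∑ S, G S = ∑ S : Finset (Fin n),
      (G (S.map (Fin.succEmb n)) + G (insert 0 (S.map (Fin.succEmb n)))) := by
  have h0 : (0 : Fin (n + 1)) ∉ Finset.univ.image Fin.succ := by simp
  have hinj : Set.InjOn (fun S : Finset (Fin n) => S.image Fin.succ) (Finset.univ : Finset (Finset (Fin n))) :=
    (Finset.image_injective (Fin.succ_injective n)).injOn
  have hu : (Finset.univ : Finset (Fin (n + 1))) = insert 0 (Finset.univ.image Fin.succ) := by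
    ext i
    refine Fin.cases ?_ (fun j => ?_) i <;> simp
  rw [← Finset.powerset_univ, hu, Finset.sum_powerset_insert h0, Finset.powerset_image,
    Finset.powerset_univ, Finset.sum_image hinj, Finset.sum_image hinj, ← Finset.sum_add_distrib]
  simp only [Finset.map_eq_image, Fin.coe_succEmb]

/-- The weighted `ℓ²` form of the one-coordinate noise operator is bounded by its value on norms. -/
theorem sum_noise_combine_le {ι : Type*} (s : Finset ι) (w a b : ι → ℝ) (hw : ∀ i, 0 ≤ w i)
    {δ A B : ℝ} (hδ : 0 < δ) (hδ1 : δ ≤ 1) (hA : 0 ≤ A) (hB : 0 ≤ B)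
    (ha : ∑ i ∈ s, w i * a i ^ 2 ≤ A ^ 2) (hb : ∑ i ∈ s, w i * b i ^ 2 ≤ B ^ 2) :
    ∑ i ∈ s, (w i * ((a i + b i) / 2) ^ 2 + w i * δ * ((a i - b i) / 2) ^ 2)
      ≤ ((A + B) / 2) ^ 2 + δ * ((A - B) / 2) ^ 2 := by
  have hcs : (∑ i ∈ s, w i * a i * b i) ^ 2
      ≤ (∑ i ∈ s, w i * a i ^ 2) * ∑ i ∈ s, w i * b i ^ 2 :=
    Finset.sum_sq_le_sum_mul_sum_of_sq_le_mul s (fun i _ => mul_nonneg (hw i) (sq_nonneg _))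
      (fun i _ => mul_nonneg (hw i) (sq_nonneg _)) (fun i _ => le_of_eq (by ring))
  have hb0 : 0 ≤ ∑ i ∈ s, w i * b i ^ 2 :=
    Finset.sum_nonneg fun i _ => mul_nonneg (hw i) (sq_nonneg _)
  have hab : ∑ i ∈ s, w i * a i * b i ≤ A * B := by
    refine le_of_sq_le_sq ?_ (mul_nonneg hA hB)
    rw [mul_pow]
    exact hcs.trans (mul_le_mul ha hb hb0 (sq_nonneg A))
  have hexp : ∑ i ∈ s, (w i * ((a i + b i) / 2) ^ 2 + w i * δ * ((a i - b i) / 2) ^ 2)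
      = (1 + δ) / 4 * ∑ i ∈ s, w i * a i ^ 2 + (1 + δ) / 4 * ∑ i ∈ s, w i * b i ^ 2
        + (1 - δ) / 2 * ∑ i ∈ s, w i * a i * b i := by
    simp only [Finset.mul_sum, ← Finset.sum_add_distrib]
    exact Finset.sum_congr rfl fun i _ => by ring
  rw [hexp]
  have h1 := mul_le_mul_of_nonneg_left ha (by linarith : 0 ≤ (1 + δ) / 4)
  have h2 := mul_le_mul_of_nonneg_left hb (by linarith : 0 ≤ (1 + δ) / 4)
  have h3 := mul_le_mul_of_nonneg_left hab (by linarith : 0 ≤ (1 - δ) / 2)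
  nlinarith

/-- The Bonami hypercontractive inequality from `L^{1+δ}` to `L²` for nonnegative functions. -/
theorem hypercontractive {n : ℕ} {δ : ℝ} (hδ : 0 < δ) (hδ1 : δ ≤ 1)
    (f : (Fin n → ZMod 2) → ℝ) (hf : ∀ x, 0 ≤ f x) :
    ∑ S : Finset (Fin n), δ ^ S.card * fhatCoeff f S ^ 2
      ≤ ((∑ x, f x ^ (1 + δ)) / 2 ^ n) ^ (2 / (1 + δ)) := by
  have hp : 0 < 1 + δ := by linarith
  induction n with
  | zero =>
    have hS : (Finset.univ : Finset (Finset (Fin 0))) = {∅} := rfl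
    rw [hS, Finset.sum_singleton]
    simp only [fhatCoeff, Finset.sum_empty, if_true, Fintype.sum_unique, pow_zero,
      Finset.card_empty, div_one, mul_one, one_mul]
    rw [← Real.rpow_mul (hf _), mul_div_cancel₀ _ hp.ne', Real.rpow_two]
  | succ n ih =>
    set E₀ := (∑ x : Fin n → ZMod 2, f (Fin.cons 0 x) ^ (1 + δ)) / 2 ^ n with hE₀
    set E₁ := (∑ x : Fin n → ZMod 2, f (Fin.cons 1 x) ^ (1 + δ)) / 2 ^ n with hE₁
    have hE₀0 : 0 ≤ E₀ :=
      div_nonneg (Finset.sum_nonneg fun x _ => Real.rpow_nonneg (hf _) _) (by positivity)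
    have hE₁0 : 0 ≤ E₁ :=
      div_nonneg (Finset.sum_nonneg fun x _ => Real.rpow_nonneg (hf _) _) (by positivity)
    have hE : (∑ x, f x ^ (1 + δ)) / 2 ^ (n + 1) = (E₀ + E₁) / 2 := by
      rw [sum_cube_succ, hE₀, hE₁]
      ring
    have hroot : ∀ E : ℝ, 0 ≤ E →
        E ^ (2 / (1 + δ)) = (E ^ (1 / (1 + δ))) ^ 2 ∧ (E ^ (1 / (1 + δ))) ^ (1 + δ) = E := by
      intro E hE0
      rw [← Real.rpow_two, ← Real.rpow_mul hE0, ← Real.rpow_mul hE0, div_mul_cancel₀ _ hp.ne',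
        Real.rpow_one]
      exact ⟨by congr 1; ring, rfl⟩
    have ih₀ := ih (fun x => f (Fin.cons 0 x)) fun x => hf _
    have ih₁ := ih (fun x => f (Fin.cons 1 x)) fun x => hf _
    rw [← hE₀, (hroot E₀ hE₀0).1] at ih₀
    rw [← hE₁, (hroot E₁ hE₁0).1] at ih₁
    have htwo := two_point_inequality hδ hδ1 (Real.rpow_nonneg hE₀0 (1 / (1 + δ)))
      (Real.rpow_nonneg hE₁0 (1 / (1 + δ)))
    rw [(hroot E₀ hE₀0).2, (hroot E₁ hE₁0).2] at htwo
    rw [hE, sum_finset_fin_succ]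
    refine le_trans ?_ htwo
    refine le_trans (le_of_eq ?_) (sum_noise_combine_le _ (fun S : Finset (Fin n) => δ ^ S.card)
      _ _ (fun S => by positivity) hδ hδ1 (Real.rpow_nonneg hE₀0 _) (Real.rpow_nonneg hE₁0 _)
      ih₀ ih₁)
    refine Finset.sum_congr rfl fun S _ => ?_
    have h0 : (0 : Fin (n + 1)) ∉ S.map (Fin.succEmb n) := by simp [Fin.succ_ne_zero]
    rw [fhatCoeff_map_succ, fhatCoeff_insert_zero_map_succ, Finset.card_insert_of_notMem h0,
      Finset.card_map, pow_succ δ]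

/-- The level-`k` inequality for nonnegative functions. -/
theorem level_inequality {n : ℕ} {δ : ℝ} (hδ : 0 < δ) (hδ1 : δ ≤ 1)
    (f : (Fin n → ZMod 2) → ℝ) (hf : ∀ x, 0 ≤ f x) (k : ℕ) :
    ∑ S ∈ Finset.powersetCard k (Finset.univ : Finset (Fin n)), fhatCoeff f S ^ 2
      ≤ (δ ^ k)⁻¹ * ((∑ x, f x ^ (1 + δ)) / 2 ^ n) ^ (2 / (1 + δ)) := by
  rw [inv_mul_eq_div, le_div_iff₀' (by positivity)]
  refine le_trans ?_ (hypercontractive hδ hδ1 f hf)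
  rw [Finset.mul_sum]
  calc ∑ S ∈ Finset.powersetCard k (Finset.univ : Finset (Fin n)), δ ^ k * fhatCoeff f S ^ 2
      = ∑ S ∈ Finset.powersetCard k (Finset.univ : Finset (Fin n)),
          δ ^ S.card * fhatCoeff f S ^ 2 :=
        Finset.sum_congr rfl fun S hS => by rw [(Finset.mem_powersetCard.1 hS).2]
    _ ≤ _ := Finset.sum_le_sum_of_subset_of_nonneg (Finset.subset_univ _)
        fun S _ _ => by positivity

/-- if `f` is a `t`-flat distribution on `{0,1}^n` with `2^t` an integer in
`{1,...,2^n}`, `q := 2^{−(n−t)}`, `0 ≤ k ≤ n` an integer and `0 < δ ≤ 1`, then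
`∑_{|S|=k} f̃(S)² ≤ (2q)^{−2}·δ^{−k}·q^{2/(1+δ)}`. -/
theorem stmt15 (n : ℕ) (hn : 1 ≤ n) (t : ℝ) (ht : 0 ≤ t)
    (hpow : ∃ s : ℕ, 1 ≤ s ∧ s ≤ 2 ^ n ∧ (s : ℝ) = (2 : ℝ) ^ t)
    (f : (Fin n → ZMod 2) → ℝ)
    (hf_nonneg : ∀ x, 0 ≤ f x) (hf_sum : ∑ x : Fin n → ZMod 2, f x = 1)
    (hf_flat : ∀ x, f x = 0 ∨ f x = (2 : ℝ) ^ (-t))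
    (q : ℝ) (hq : q = (2 : ℝ) ^ (-((n : ℝ) - t)))
    (k : ℕ) (hkn : k ≤ n) (δ : ℝ) (hδ : 0 < δ) (hδ1 : δ ≤ 1) :
    (∑ S ∈ Finset.powersetCard k (Finset.univ : Finset (Fin n)), (ntildeCoeff f S) ^ 2)
      ≤ ((2 * q) ^ 2)⁻¹ * (δ ^ k)⁻¹ * q ^ (2 / (1 + δ)) := by
  have hn2 : (2 : ℝ) ^ n = 2 * 2 ^ (n - 1) := by
    rw [← pow_succ', Nat.sub_add_cancel hn]
  have ht0 : (0 : ℝ) < 2 ^ t := by positivity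
  have hq0 : 0 < q := hq ▸ by positivity
  have hq' : q = 2 ^ t / 2 ^ n := by
    rw [hq, neg_sub, Real.rpow_sub two_pos, Real.rpow_natCast]
  set g : (Fin n → ZMod 2) → ℝ := fun x => 2 ^ t * f x with hg
  have hscale : ∀ S, ntildeCoeff f S = (2 * q)⁻¹ * fhatCoeff g S := by
    intro S
    have hsum : ∀ c : (Fin n → ZMod 2) → ℝ, ∑ x, g x * c x = 2 ^ t * ∑ x, f x * c x := by
      intro c
      rw [Finset.mul_sum]
      exact Finset.sum_congr rfl fun x _ => mul_assoc _ _ _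
    rw [ntildeCoeff, fhatCoeff, fhatCoeff, hsum, hq', hn2]
    field_simp
  have hmoment : (∑ x, g x ^ (1 + δ)) / 2 ^ n = q := by
    have hx : ∀ x, g x ^ (1 + δ) = 2 ^ t * f x := by
      intro x
      rcases hf_flat x with h | h
      · simp only [hg, h, mul_zero]
        exact Real.zero_rpow (by linarith)
      · simp only [hg, h]
        rw [← Real.rpow_add two_pos, add_neg_cancel, Real.rpow_zero, Real.one_rpow]
    rw [Finset.sum_congr rfl fun x _ => hx x, ← Finset.mul_sum, hf_sum, mul_one, hq']
  have hlevel := level_inequality hδ hδ1 g (fun x => mul_nonneg ht0.le (hf_nonneg x)) k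
  rw [hmoment] at hlevel
  simp only [hscale, mul_pow (2 * q)⁻¹, ← Finset.mul_sum, inv_pow]
  rw [mul_assoc]
  exact mul_le_mul_of_nonneg_left hlevel (by positivity)
end
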